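/- Let R_loc be the localization of Z[q^{±1}] at the multiplicative set generated by {n} = q^{2n} - q^{-2n} for all n ≥ 1. Then (R̂[y]/G) ⊗_{Z[q^{±1}]} R_loc ≅ R_loc[x_1, x_2] as R_loc-modules, where R̂ = Z[q^{±1}][x_1,x_2] and G is the R̂-span of G_n = {n+1}·S_n(y) + (-1)^{n+1}·{1}·S_n(x_1)·S_n(x_2), n ≥ 1. -/

import Mathlib

set_option synthInstance.maxHeartbeats 1000000

open Polynomial

/-- Chebyshev polynomials of the second kind (nonnegative index):
`S 0 = 1`, `S 1 = X`, `S (n+2) = X * S (n+1) - S n`. -/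
noncomputable def chebS' : ℕ → Polynomial ℤ
  | 0 => 1
  | 1 => X
  | (n + 2) => X * chebS' (n + 1) - chebS' n

/-- Chebyshev polynomials of the first kind (nonnegative index):
`T 0 = 2`, `T 1 = X`, `T (n+2) = X * T (n+1) - T n`. -/
noncomputable def chebT' : ℕ → Polynomial ℤ
  | 0 => 2
  | 1 => X
  | (n + 2) => X * chebT' (n + 1) - chebT' n

/-- Chebyshev polynomials of the second kind extended to all integer indices,
characterized by `S n (u + u⁻¹) = (u^(n+1) - u^(-n-1))/(u - u⁻¹)`. -/
noncomputable def chebS (n : ℤ) : Polynomial ℤ :=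
  if 0 ≤ n then chebS' n.toNat else if n = -1 then 0 else - chebS' (-n - 2).toNat

/-- Chebyshev polynomials of the first kind extended to all integer indices,
characterized by `T n (u + u⁻¹) = u^n + u^(-n)`. -/
noncomputable def chebT (n : ℤ) : Polynomial ℤ :=
  if 0 ≤ n then chebT' n.toNat else chebT' (-n).toNat

/-- The ground ring `R̂ = ℤ[q^{±1}][x₁,x₂]`. -/
noncomputable abbrev Rhat : Type := MvPolynomial (Fin 2) (LaurentPolynomial ℤ)

/-- `{m} = q^(2m) - q^(-2m)` in `ℤ[q^{±1}]`. -/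
noncomputable def brk (m : ℤ) : LaurentPolynomial ℤ :=
  LaurentPolynomial.T (2 * m) - LaurentPolynomial.T (-(2 * m))

/-- `{m}` viewed in `R̂`. -/
noncomputable def brkR (m : ℤ) : Rhat := algebraMap (LaurentPolynomial ℤ) Rhat (brk m)

/-- `S_k(y)` as an element of `R̂[y]`. -/
noncomputable def Spoly (k : ℤ) : Polynomial Rhat := (chebS k).map (Int.castRingHom Rhat)

/-- `S_k(xᵢ)` as an element of `R̂`. -/
noncomputable def Sx (i : Fin 2) (k : ℤ) : Rhat := Polynomial.aeval (MvPolynomial.X i) (chebS k)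

/-- `G_k = {k+1}·S_k(y) + (-1)^(k+1)·{1}·S_k(x₁)·S_k(x₂)` in `R̂[y]`. -/
noncomputable def Gpoly (k : ℤ) : Polynomial Rhat :=
  Polynomial.C (brkR (k + 1)) * Spoly k +
    Polynomial.C (((Int.negOnePow (k + 1) : ℤ) : Rhat) * brkR 1 * Sx 0 k * Sx 1 k)

open TensorProduct

/-- The submodule `G ⊂ R̂[y]` spanned by `{G_n : n ≥ 1}`. -/
noncomputable def Gsub : Submodule Rhat (Polynomial Rhat) :=
  Submodule.span Rhat (Set.range (fun n : ℕ+ => Gpoly (n : ℕ)))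

/-- The localization `R_loc` of `ℤ[q^{±1}]` at the multiplicative set generated by
all `{n} = q^(2n) - q^(-2n)`, `n ≥ 1`. -/
noncomputable abbrev Rloc : Type :=
  Localization (Submonoid.closure {x : LaurentPolynomial ℤ | ∃ n : ℕ, 1 ≤ n ∧ x = brk n})

attribute [local instance] MvPolynomial.algebraMvPolynomial in
/-- Let `b` be a basis of `A[σ][y]` over `A[σ]` with `b 0 = 1`. If the `a n` become invertible in
`L`, then imposing the relations `a n * b n = c n` for `n ≥ 1` on `L ⊗ A[σ][y]` leaves `L[σ]`. -/
theorem exists_surjective_ker_eq_span_of_basis {A L σ : Type*} [CommRing A] [CommRing L]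
    [Algebra A L] (b : Module.Basis ℕ (MvPolynomial σ A) (Polynomial (MvPolynomial σ A)))
    (hb : b 0 = 1) (a : ℕ → A) (ha : ∀ n, IsUnit (algebraMap A L (a n)))
    (c : ℕ → MvPolynomial σ A) (hc : c 0 = MvPolynomial.C (a 0)) :
    ∃ f : (L ⊗[A] Polynomial (MvPolynomial σ A)) →ₗ[L] MvPolynomial σ L,
      Function.Surjective f ∧
      LinearMap.ker f = Submodule.span L
        {x : L ⊗[A] Polynomial (MvPolynomial σ A) |
          ∃ g ∈ Submodule.span (MvPolynomial σ A) (Set.range fun n : ℕ+ =>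
            C (MvPolynomial.C (a n)) * b n - C (c n)), x = 1 ⊗ₜ g} := by
  let G : ℕ → Polynomial (MvPolynomial σ A) := fun n => C (MvPolynomial.C (a n)) * b n - C (c n)
  set N := Submodule.span (MvPolynomial σ A) (Set.range fun n : ℕ+ => G n)
  set K := Submodule.span L {x : L ⊗[A] Polynomial (MvPolynomial σ A) | ∃ g ∈ N, x = 1 ⊗ₜ g}
  let φ : Polynomial (MvPolynomial σ A) →ₗ[MvPolynomial σ A] MvPolynomial σ L :=
    b.constr ℕ fun n =>
      Ring.inverse (algebraMap A L (a n)) • MvPolynomial.map (algebraMap A L) (c n)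
  have hφ_smul (r p) : φ (r • p) = MvPolynomial.map (algebraMap A L) r * φ p := by
    rw [map_smul, Algebra.smul_def, MvPolynomial.algebraMap_def]
  have hφb (n : ℕ) : φ (b n) =
      Ring.inverse (algebraMap A L (a n)) • MvPolynomial.map (algebraMap A L) (c n) :=
    b.constr_basis ..
  have hφC (r : MvPolynomial σ A) : φ (C r) = MvPolynomial.map (algebraMap A L) r := by
    have : C r = r • b 0 := by rw [hb, Polynomial.smul_eq_C_mul, mul_one]
    rw [this, hφ_smul, hφb, hc, MvPolynomial.map_C, MvPolynomial.smul_eq_C_mul, ← map_mul,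
      Ring.inverse_mul_cancel _ (ha 0), map_one, mul_one]
  have hφG (n : ℕ) : φ (G n) = 0 := by
    rw [map_sub, ← Polynomial.smul_eq_C_mul, hφ_smul, hφb, hφC,
      MvPolynomial.map_C, MvPolynomial.smul_eq_C_mul, ← mul_assoc, ← map_mul,
      Ring.mul_inverse_cancel _ (ha n), map_one, one_mul, sub_self]
  have hGN (n : ℕ) : G n ∈ N := by
    rcases n.eq_zero_or_pos with rfl | hn
    · simp [G, hb, hc]
    · exact Submodule.subset_span ⟨⟨n, hn⟩, rfl⟩
  let f := (φ.restrictScalars A).liftBaseChange L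
  have hf (l : L) (p) : f (l ⊗ₜ p) = l • φ p := rfl
  let g : MvPolynomial σ L →ₗ[L] L ⊗[A] Polynomial (MvPolynomial σ A) :=
    (Polynomial.CAlgHom (R := A) (A := MvPolynomial σ A)).toLinearMap.baseChange L ∘ₗ
      (MvPolynomial.algebraTensorAlgEquiv A L (σ := σ)).symm.toLinearMap
  have hg (r : MvPolynomial σ A) : g (MvPolynomial.map (algebraMap A L) r) = 1 ⊗ₜ C r := by
    simp [g]
  have hfg (m : MvPolynomial σ L) : f (g m) = m := by
    induction m using MvPolynomial.induction_on' with
    | monomial s l =>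
      have : MvPolynomial.monomial s l =
          l • MvPolynomial.map (algebraMap A L) (MvPolynomial.monomial s 1) := by
        simp [MvPolynomial.smul_monomial]
      rw [this, map_smul, map_smul, hg, hf, hφC, one_smul]
    | add p q hp hq => rw [map_add, map_add, hp, hq]
  have hgf_basis (n : ℕ) (r : MvPolynomial σ A) :
      K.mkQ (1 ⊗ₜ (r • b n)) = K.mkQ (g (f (1 ⊗ₜ (r • b n)))) := by
    have hφr : algebraMap A L (a n) • φ (r • b n) = MvPolynomial.map (algebraMap A L) (r * c n) := by
      rw [hφ_smul, hφb, mul_smul_comm, smul_smul, Ring.mul_inverse_cancel _ (ha n), one_smul,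
        map_mul]
    have hrG : a n • r • b n = r • G n + C (r * c n) := by
      rw [← algebraMap_smul (MvPolynomial σ A) (a n), MvPolynomial.algebraMap_eq]
      simp only [G, Polynomial.smul_eq_C_mul, map_mul]
      ring
    have hK : K.mkQ (1 ⊗ₜ (r • G n)) = 0 :=
      (Submodule.Quotient.mk_eq_zero K).2
        (Submodule.subset_span ⟨_, N.smul_mem r (hGN n), rfl⟩)
    refine (ha n).smul_left_cancel.1 ?_
    rw [hf, one_smul, ← map_smul K.mkQ, ← map_smul K.mkQ, ← map_smul g, hφr, hg, algebraMap_smul,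
      ← TensorProduct.tmul_smul, hrG, TensorProduct.tmul_add, map_add, hK, zero_add]
  have hgf (t) : K.mkQ t = K.mkQ (g (f t)) := by
    induction t using TensorProduct.induction_on with
    | zero => simp only [map_zero]
    | add x y hx hy => simp only [map_add, hx, hy]
    | tmul l p =>
      have : l ⊗ₜ[A] p = l • (1 ⊗ₜ[A] p) := by simp [TensorProduct.smul_tmul']
      simp only [this, map_smul]
      rw [← b.linearCombination_repr p, Finsupp.linearCombination_apply, Finsupp.sum,
        TensorProduct.tmul_sum]
      simp only [map_sum, ← hgf_basis]
  refine ⟨f, fun m => ⟨g m, hfg m⟩, le_antisymm (fun t ht => ?_) (Submodule.span_le.2 ?_)⟩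
  · refine (Submodule.Quotient.mk_eq_zero K).1 ((hgf t).trans ?_)
    rw [LinearMap.mem_ker.1 ht, map_zero, map_zero]
  · rintro _ ⟨p, hp, rfl⟩
    have hN : N ≤ LinearMap.ker φ := by
      rw [Submodule.span_le]
      rintro _ ⟨n, rfl⟩
      exact hφG n
    change f _ = 0
    rw [hf, one_smul]
    exact hN hp

theorem chebS_natCast (n : ℕ) : chebS n = chebS' n := by simp [chebS]

theorem monic_chebS'_and_natDegree (n : ℕ) : (chebS' n).Monic ∧ (chebS' n).natDegree = n := by
  induction n using Nat.twoStepInduction with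
  | zero => simp [chebS']
  | one => simp [chebS', monic_X]
  | more n h₀ h₁ =>
    have hmonic : (X * chebS' (n + 1)).Monic := monic_X.mul h₁.1
    have hdeg : (X * chebS' (n + 1)).natDegree = n + 2 := by
      rw [monic_X.natDegree_mul h₁.1, natDegree_X, h₁.2]
      omega
    have hlt : (chebS' n).natDegree < (X * chebS' (n + 1)).natDegree := by omega
    rw [chebS']
    exact ⟨hmonic.sub_of_left (degree_lt_degree hlt),
      (natDegree_sub_eq_left_of_natDegree_lt hlt).trans hdeg⟩

theorem monic_Spoly (n : ℕ) : (Spoly n).Monic := by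
  rw [Spoly, chebS_natCast]
  exact (monic_chebS'_and_natDegree n).1.map _

theorem degree_Spoly (n : ℕ) : (Spoly n).degree = n := by
  rw [Spoly, chebS_natCast, (monic_chebS'_and_natDegree n).1.degree_map,
    degree_eq_natDegree (monic_chebS'_and_natDegree n).1.ne_zero, (monic_chebS'_and_natDegree n).2]

/-- The Chebyshev polynomials `S_n(y)` form an `R̂`-basis of `R̂[y]`. -/
noncomputable def basisSpoly : Module.Basis ℕ Rhat (Polynomial Rhat) :=
  Polynomial.Sequence.basis ⟨fun n => Spoly n, degree_Spoly⟩ fun n => by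
    rw [(monic_Spoly n).leadingCoeff]
    exact isUnit_one

theorem basisSpoly_apply (n : ℕ) : basisSpoly n = Spoly n :=
  Polynomial.Sequence.basis_eq_self ..

theorem isUnit_algebraMap_brk (n : ℕ) :
    IsUnit (algebraMap (LaurentPolynomial ℤ) Rloc (brk ((n : ℤ) + 1))) :=
  IsLocalization.map_units Rloc
    (⟨_, Submonoid.subset_closure ⟨n + 1, Nat.le_add_left 1 n, by push_cast; rfl⟩⟩ :
      Submonoid.closure {x : LaurentPolynomial ℤ | ∃ n : ℕ, 1 ≤ n ∧ x = brk n})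

/-- `(R̂[y]/G) ⊗_{ℤ[q^{±1}]} R_loc ≅ R_loc[x₁,x₂]` as `R_loc`-modules.
Equivalently (right-exactness of the tensor product and the first isomorphism
theorem): there is a surjective `R_loc`-linear map
`R_loc ⊗_{ℤ[q^{±1}]} R̂[y] → R_loc[x₁,x₂]` whose kernel is generated by the image
`1 ⊗ G` of `G`. -/
theorem localized_skein_module_free :
    ∃ f : (Rloc ⊗[LaurentPolynomial ℤ] Polynomial Rhat) →ₗ[Rloc] MvPolynomial (Fin 2) Rloc,
      Function.Surjective f ∧
      LinearMap.ker f = Submodule.span Rloc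
        {x : Rloc ⊗[LaurentPolynomial ℤ] Polynomial Rhat | ∃ g ∈ Gsub, x = 1 ⊗ₜ g} := by
  obtain ⟨f, hsurj, hker⟩ := exists_surjective_ker_eq_span_of_basis (L := Rloc) basisSpoly
    (by rw [basisSpoly_apply, Spoly, chebS_natCast]; simp [chebS'])
    (fun n => brk ((n : ℤ) + 1)) isUnit_algebraMap_brk
    (fun n => -(((Int.negOnePow ((n : ℤ) + 1) : ℤ) : Rhat) * brkR 1 * Sx 0 n * Sx 1 n))
    (by
      simp only [Sx, chebS_natCast]
      simp [chebS', brkR]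
      ring)
  refine ⟨f, hsurj, hker.trans ?_⟩
  have hG (n : ℕ) : C (MvPolynomial.C (brk ((n : ℤ) + 1))) * basisSpoly n -
      C (-(((Int.negOnePow ((n : ℤ) + 1) : ℤ) : Rhat) * brkR 1 * Sx 0 n * Sx 1 n)) = Gpoly n := by
    rw [basisSpoly_apply, Gpoly, C_neg,
      show MvPolynomial.C (brk ((n : ℤ) + 1)) = brkR ((n : ℤ) + 1) from rfl]
    ring
  simp only [hG]
  rfl
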